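/- arXiv:1401.3325 — 2 statements merged into one kernel-verified Lean document; each statement's English description precedes it below -/
import Mathlib

section
/- Let A and O be nonempty sets and for each a ∈ A let ≺_a be a strict linear order on O such that: (i) for each a ∈ A there is no sequence (o_k)_{k∈ℕ} in O with o_k ≺_a o_{k+1} for all k (the inverse preferences are well-founded); (ii) there are no players a, b ∈ A and outcomes x, y, z ∈ O with z ≺_a y ≺_a x and x ≺_b z ≺_b y. Then every infinite sequential game ⟨A, C, d, O, v, (≺_a)_{a∈A}⟩ with v surjective (every outcome is realizable) such that for every O' ⊆ O, every γ ∈ C*, and every D ⊆ C*, the two-player win/lose game ⟨C, D, v^{-1}(O') ∩ γC^ω⟩ is determined, has a Pareto-optimal Nash equilibrium. -/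
namespace SeqGame

variable {A C O : Type*}

/-- The length-`n` prefix of an infinite sequence, as a list. -/
def pre (p : ℕ → C) (n : ℕ) : List C := List.ofFn (fun i : Fin n => p i)

/-- The length-`n` history of the play induced by the strategy profile `σ` starting at `γ`. -/
def hist (σ : List C → C) (γ : List C) : ℕ → List C
  | 0 => []
  | n + 1 => hist σ γ n ++
      [if h : n < γ.length then γ.get ⟨n, h⟩ else σ (hist σ γ n)]

/-- The play `p^γ(σ)` induced by the strategy profile `σ` starting at `γ`. -/
def play (σ : List C → C) (γ : List C) (n : ℕ) : C :=
  if h : n < γ.length then γ.get ⟨n, h⟩ else σ (hist σ γ n)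

/-- `σ'` is an `a`-deviation of the strategy profile `σ`. -/
def Dev (d : List C → A) (a : A) (σ σ' : List C → C) : Prop :=
  ∀ h : List C, d h ≠ a → σ' h = σ h

/-- `r` is a strict linear order: irreflexive, transitive and total. -/
def SLO (r : O → O → Prop) : Prop :=
  (∀ x, ¬ r x x) ∧ (∀ x y z, r x y → r y z → r x z) ∧
  (∀ x y, x = y ∨ r x y ∨ r y x)

/-- `γ C^ω`: the set of plays extending the finite sequence `γ`. -/
def ext (γ : List C) : Set (ℕ → C) := {p | pre p γ.length = γ}

/-- The two-player win/lose game `⟨C, D, W⟩` is determined. -/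
def Determined (D : Set (List C)) (W : Set (ℕ → C)) : Prop :=
  (∃ s : List C → C, ∀ p : ℕ → C, (∀ n, pre p n ∈ D → p n = s (pre p n)) → p ∈ W) ∨
  (∃ t : List C → C, ∀ p : ℕ → C, (∀ n, pre p n ∉ D → p n = t (pre p n)) → p ∉ W)

/-- Preferences of the two players (`true` is player `a`, `false` is player `b`). -/
def rel2 (rA rB : O → O → Prop) : Bool → O → O → Prop
  | true => rA
  | false => rB

/-- The outcome `o` is Pareto-optimal: no other realizable outcome `q` is such that some
player prefers `q` to `o` while no player prefers `o` to `q`. -/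
def ParetoOpt (v : (ℕ → C) → O) (prec : A → O → O → Prop) (o : O) : Prop :=
  ¬ ∃ q : O, q ≠ o ∧ (∃ p : ℕ → C, v p = q) ∧
    (∃ c : A, prec c o q) ∧ (∀ c : A, ¬ prec c q o)

end SeqGame


namespace SeqGame

variable {A C O : Type*}

theorem pre_succ (p : ℕ → C) (n : ℕ) : pre p (n + 1) = pre p n ++ [p n] := by
  rw [pre, List.ofFn_succ_last]
  rfl

@[simp] theorem length_pre (p : ℕ → C) (n : ℕ) : (pre p n).length = n := by
  simp [pre]

theorem pre_eq_pre_iff {p q : ℕ → C} {n : ℕ} : pre p n = pre q n ↔ ∀ k < n, p k = q k := by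
  simp [pre, List.ofFn_inj, funext_iff, Fin.forall_iff]

theorem pre_eq_of_mem_ext {p q : ℕ → C} {m n : ℕ} (h : q ∈ ext (pre p n)) (hm : m ≤ n) :
    pre q m = pre p m := by
  have h' : pre q n = pre p n := by simpa [ext] using h
  exact pre_eq_pre_iff.2 fun k hk => pre_eq_pre_iff.1 h' k (hk.trans_le hm)

theorem ext_pre_anti (q : ℕ → C) {m n : ℕ} (h : n ≤ m) : ext (pre q m) ⊆ ext (pre q n) := by
  intro p hp
  simpa [ext] using pre_eq_of_mem_ext hp h

theorem hist_eq_pre (σ : List C → C) (γ : List C) (n : ℕ) :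
    hist σ γ n = pre (play σ γ) n := by
  induction n with
  | zero => simp [hist, pre]
  | succ n ih =>
    rw [pre_succ, ← ih]
    rfl

theorem play_of_length_le (σ : List C → C) {γ : List C} {n : ℕ} (h : γ.length ≤ n) :
    play σ γ n = σ (pre (play σ γ) n) := by
  rw [← hist_eq_pre]
  simp [play, Nat.not_lt.2 h]

theorem play_nil (σ : List C → C) (n : ℕ) : play σ [] n = σ (pre (play σ []) n) :=
  play_of_length_le σ (Nat.zero_le n)

theorem play_mem_ext (σ : List C → C) (γ : List C) : play σ γ ∈ ext γ := by
  refine List.ext_getElem (length_pre _ _) fun i _ h => ?_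
  simp [pre, play]

/-- The owner of the positions in `D` can force the outcome into `S` once `γ` is reached. -/
def Wins (v : (ℕ → C) → O) (D : Set (List C)) (γ : List C) (S : Set O) : Prop :=
  ∃ s : List C → C, ∀ p ∈ ext γ,
    (∀ n, γ.length ≤ n → pre p n ∈ D → p n = s (pre p n)) → v p ∈ S

theorem Wins.mono {v : (ℕ → C) → O} {D D' : Set (List C)} {γ : List C} {S S' : Set O}
    (h : Wins v D γ S) (hD : D ⊆ D') (hS : S ⊆ S') : Wins v D' γ S' := by
  obtain ⟨s, hs⟩ := h
  exact ⟨s, fun p hp h => hS (hs p hp fun n hn hD' => h n hn (hD hD'))⟩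

theorem wins_of_forall [Nonempty C] {v : (ℕ → C) → O} {D : Set (List C)} {γ : List C}
    {S : Set O} (h : ∀ o, o ∈ S) : Wins v D γ S :=
  ⟨fun _ => Classical.arbitrary C, fun _ _ _ => h _⟩

/-- Letting the owner of `D` choose every move before `γ` turns determinacy of games
restricted to `ext γ` into determinacy of the subgames at `γ`. -/
theorem wins_or_wins_compl {v : (ℕ → C) → O} {S : Set O} {γ : List C} (D : Set (List C))
    (hdet : ∀ E : Set (List C), Determined E (v ⁻¹' S ∩ ext γ)) :
    Wins v D γ S ∨ Wins v Dᶜ γ Sᶜ := by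
  rcases hdet (D ∪ {h | h.length < γ.length}) with ⟨s, hs⟩ | ⟨t, ht⟩
  · left
    refine ⟨s, fun p hp h => (hs p fun n hn => ?_).1⟩
    by_cases hlt : n < γ.length
    · have hq := (hs (play s []) fun n _ => play_nil s n).2
      have heq : pre p γ.length = pre (play s []) γ.length := by
        rw [show pre p γ.length = γ from hp, show pre (play s []) γ.length = γ from hq]
      rw [pre_eq_pre_iff] at heq
      rw [heq n hlt, pre_eq_pre_iff.2 fun k hk => heq k (hk.trans hlt), ← play_nil s]
    · exact h n (not_lt.1 hlt) (hn.resolve_right (by simpa using hlt))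
  · right
    refine ⟨t, fun p hp h hv => ht p (fun n hn => ?_) ⟨hv, hp⟩⟩
    simp only [Set.mem_union, Set.mem_ofPred_eq, length_pre, not_or, not_lt] at hn
    exact h n hn.2 hn.1

/-- A pair of winning strategies at `γ` produces a play along which both keep winning. -/
theorem exists_play_of_wins {v : (ℕ → C) → O} {D : Set (List C)} {γ : List C} {S S' : Set O}
    (h : Wins v D γ S) (h' : Wins v Dᶜ γ S') :
    ∃ p ∈ ext γ, v p ∈ S ∩ S' ∧
      ∀ n, γ.length ≤ n → Wins v D (pre p n) S ∧ Wins v Dᶜ (pre p n) S' := by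
  classical
  obtain ⟨s, hs⟩ := h
  obtain ⟨t, ht⟩ := h'
  set p := play (fun h => if h ∈ D then s h else t h) γ with hp
  have hpext : p ∈ ext γ := play_mem_ext _ γ
  have key : ∀ n, γ.length ≤ n →
      p n = if pre p n ∈ D then s (pre p n) else t (pre p n) :=
    fun n hn => play_of_length_le _ hn
  have hsub : ∀ n, γ.length ≤ n → ∀ q ∈ ext (pre p n), q ∈ ext γ := by
    intro n hn q hq
    have := ext_pre_anti p hn hq
    rwa [show pre p γ.length = γ from hpext] at this
  have hagree : ∀ n, ∀ q ∈ ext (pre p n), ∀ m < n, q m = p m ∧ pre q m = pre p m := by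
    intro n q hq m hm
    exact ⟨pre_eq_pre_iff.1 (pre_eq_of_mem_ext hq le_rfl) m hm, pre_eq_of_mem_ext hq hm.le⟩
  have hS : ∀ n, γ.length ≤ n → Wins v D (pre p n) S := by
    refine fun n hn => ⟨s, fun q hq h => hs q (hsub n hn q hq) fun m hm hD => ?_⟩
    by_cases hmn : m < n
    · obtain ⟨h1, h2⟩ := hagree n q hq m hmn
      rw [h2] at hD ⊢
      rw [h1, key m hm, if_pos hD]
    · exact h m (by simpa using hmn) hD
  have hS' : ∀ n, γ.length ≤ n → Wins v Dᶜ (pre p n) S' := by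
    refine fun n hn => ⟨t, fun q hq h => ht q (hsub n hn q hq) fun m hm hD => ?_⟩
    by_cases hmn : m < n
    · obtain ⟨h1, h2⟩ := hagree n q hq m hmn
      rw [h2] at hD ⊢
      rw [h1, key m hm, if_neg hD]
    · exact h m (by simpa using hmn) hD
  refine ⟨p, hpext, ⟨hs p hpext fun n hn hD => ?_, ht p hpext fun n hn hD => ?_⟩,
    fun n hn => ⟨hS n hn, hS' n hn⟩⟩
  · rw [key n hn, if_pos hD]
  · rw [key n hn, if_neg hD]

/-- A play is induced by a Nash equilibrium as soon as, at each of its positions, the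
opponents of the player who moves there can punish this player for leaving the play. -/
theorem exists_nash_of_forall_wins {v : (ℕ → C) → O} {prec : A → O → O → Prop}
    (hirr : ∀ a o, ¬ prec a o o) {d : List C → A} (p : ℕ → C)
    (hp : ∀ n, Wins v {h | d h ≠ d (pre p n)} (pre p n)
      {o | ¬ prec (d (pre p n)) (v p) o}) :
    ∃ σ : List C → C, play σ [] = p ∧
      ∀ (a : A) (σ' : List C → C), Dev d a σ σ' →
        ¬ prec a (v (play σ [])) (v (play σ' [])) := by
  classical
  choose t ht using hp
  let σ : List C → C := fun h =>
    if hne : ∃ n, h.take (n + 1) ≠ pre p (n + 1) ∧ n < h.length then t (Nat.find hne) h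
    else p h.length
  have take_pre : ∀ (q : ℕ → C) (m n : ℕ), m ≤ n → (pre q n).take m = pre q m := by
    intro q m n hmn
    refine List.ext_getElem (by simpa using hmn) fun i h1 h2 => ?_
    simp [pre]
  have on_play : ∀ n, σ (pre p n) = p n := by
    intro n
    have : ¬ ∃ k, (pre p n).take (k + 1) ≠ pre p (k + 1) ∧ k < (pre p n).length := by
      rintro ⟨k, hk, hkn⟩
      exact hk (take_pre p _ _ (by simpa using hkn))
    simp only [σ, dif_neg this, length_pre]
  have off_play : ∀ (q : ℕ → C) (n m : ℕ), pre q n = pre p n → q n ≠ p n → n < m →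
      σ (pre q m) = t n (pre q m) := by
    intro q n m hq hn hm
    have hex : ∃ k, (pre q m).take (k + 1) ≠ pre p (k + 1) ∧ k < (pre q m).length := by
      refine ⟨n, ?_, by simpa using hm⟩
      rw [take_pre q _ _ hm]
      exact fun h => hn (pre_eq_pre_iff.1 h n n.lt_succ_self)
    have hfind : Nat.find hex = n := by
      rw [Nat.find_eq_iff]
      refine ⟨⟨?_, by simpa using hm⟩, fun k hk hk' => hk'.1 ?_⟩
      · rw [take_pre q _ _ hm]
        exact fun h => hn (pre_eq_pre_iff.1 h n n.lt_succ_self)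
      · rw [take_pre q _ _ (by omega)]
        exact pre_eq_pre_iff.2 fun j hj => pre_eq_pre_iff.1 hq j (by omega)
    simp only [σ, dif_pos hex, hfind]
  have hσ : play σ [] = p := by
    funext n
    induction n using Nat.strong_induction_on with
    | _ n ih => rw [play_nil, pre_eq_pre_iff.2 ih, on_play]
  refine ⟨σ, hσ, fun a σ' hdev => ?_⟩
  rw [hσ]
  set q := play σ' [] with hqdef
  by_cases hqp : ∃ n, q n ≠ p n
  · have hn := Nat.find_spec hqp
    have hmin : pre q (Nat.find hqp) = pre p (Nat.find hqp) :=
      pre_eq_pre_iff.2 fun k hk => not_not.1 (Nat.find_min hqp hk)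
    generalize Nat.find hqp = n at hn hmin
    have ha : d (pre p n) = a := by
      by_contra hne
      apply hn
      rw [hqdef, play_nil, ← hqdef, hmin, hdev _ hne, on_play]
    have := ht n q (by simpa [ext] using hmin) fun m hm hmd => by
      have hmd' : d (pre q m) ≠ a := by rw [← ha]; exact hmd
      have hnm : n ≠ m := by
        rintro rfl
        exact hmd' (by rw [hmin, ha])
      rw [← off_play q n m hmin hn (lt_of_le_of_ne (by simpa using hm) hnm),
        ← hdev _ hmd', hqdef, ← play_nil σ']
    rwa [ha] at this
  · push Not at hqp
    rw [funext hqp]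
    exact hirr a _

/-- Without infinite ascending chains, every nonempty set has a maximal element. -/
theorem exists_maximal_of_no_chain {r : O → O → Prop}
    (hwf : ¬ ∃ o : ℕ → O, ∀ k, r (o k) (o (k + 1))) {S : Set O} (hS : S.Nonempty) :
    ∃ m ∈ S, ∀ w ∈ S, ¬ r m w := by
  by_contra! h
  choose! f hfS hf using h
  obtain ⟨o, ho⟩ := hS
  have hmem : ∀ k, f^[k] o ∈ S := fun k => by
    induction k with
    | zero => exact ho
    | succ k ih => rw [Function.iterate_succ_apply']; exact hfS _ ih
  exact hwf ⟨fun k => f^[k] o, fun k => by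
    simpa only [Function.iterate_succ_apply'] using hf _ (hmem k)⟩

/-- If the owner of `D` can force the outcome into `T`, on which the two preferences are
opposite, then some play from `γ` is an equilibrium between the two coalitions. -/
theorem exists_play_of_wins_slice {v : (ℕ → C) → O} {D : Set (List C)} {γ : List C}
    {T : Set O} {r s : O → O → Prop} (hr : SLO r)
    (hwr : ¬ ∃ o : ℕ → O, ∀ k, r (o k) (o (k + 1)))
    (hws : ¬ ∃ o : ℕ → O, ∀ k, s (o k) (o (k + 1)))
    (hT : T.Nonempty) (hrT : ∀ z w, z ∈ T → r z w → w ∈ T)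
    (hsT : ∀ z w, z ∈ T → s z w → w ∈ T)
    (hrs : ∀ z w, z ∈ T → w ∈ T → (r z w ↔ s w z))
    (hdet : ∀ (S : Set O) (E : Set (List C)), Determined E (v ⁻¹' S ∩ ext γ))
    (hwin : Wins v D γ T) :
    ∃ p ∈ ext γ, v p ∈ T ∧ ∀ n, γ.length ≤ n →
      Wins v Dᶜ (pre p n) {o | ¬ r (v p) o} ∧ Wins v D (pre p n) {o | ¬ s (v p) o} := by
  obtain ⟨hirr, htrans, htotal⟩ := hr
  obtain ⟨y, hyT, hy⟩ := exists_maximal_of_no_chain hws hT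
  have hyS : y ∈ {z | z ∈ T ∧ Wins v D γ {w | ¬ r w z}} :=
    ⟨hyT, hwin.mono subset_rfl fun w hw hwy => hy w hw ((hrs w y hw hyT).1 hwy)⟩
  obtain ⟨i, ⟨hiT, hi⟩, himax⟩ := exists_maximal_of_no_chain hwr ⟨y, hyS⟩
  have hopp : Wins v Dᶜ γ {w | ¬ r i w} := by
    refine (wins_or_wins_compl D fun E => hdet {w | r i w} E).resolve_left fun h => ?_
    obtain ⟨j, hij, hj⟩ : ∃ j ∈ {w | r i w}, ∀ w ∈ {w | r i w}, ¬ s j w := by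
      refine exists_maximal_of_no_chain hws ?_
      exact ⟨_, (exists_play_of_wins h (S' := Set.univ)
        ⟨h.choose, fun _ _ _ => trivial⟩).choose_spec.2.1.1⟩
    have hjT := hrT i j hiT hij
    exact himax j ⟨hjT, h.mono subset_rfl fun w hw hwj =>
      hj w hw ((hrs w j (hrT i w hiT hw) hjT).1 hwj)⟩ hij
  obtain ⟨p, hp, ⟨h1, h2⟩, hp'⟩ := exists_play_of_wins hi hopp
  have hvp : v p = i := by
    rcases htotal (v p) i with h | h | h
    · exact h
    · exact absurd h h1
    · exact absurd h h2
  refine ⟨p, hp, hvp ▸ hiT, fun n hn => ?_⟩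
  rw [hvp]
  exact ⟨(hp' n hn).2, (hp' n hn).1.mono subset_rfl fun w hw hiw =>
    hw ((hrs w i (hsT i w hiT hiw) hiT).2 hiw)⟩

/-- Two coalitions with opposite preferences on a realizable set `T` of best outcomes have
an equilibrium play with outcome in `T`. -/
theorem exists_play_in_slice {v : (ℕ → C) → O} (D : Set (List C))
    {T : Set O} {r s : O → O → Prop} (hr : SLO r) (hs : SLO s)
    (hwr : ¬ ∃ o : ℕ → O, ∀ k, r (o k) (o (k + 1)))
    (hws : ¬ ∃ o : ℕ → O, ∀ k, s (o k) (o (k + 1)))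
    (hT : ∃ p, v p ∈ T) (hrT : ∀ z w, z ∈ T → r z w → w ∈ T)
    (hsT : ∀ z w, z ∈ T → s z w → w ∈ T)
    (hrs : ∀ z w, z ∈ T → w ∈ T → (r z w ↔ s w z))
    (hdet : ∀ (S : Set O) (γ : List C) (E : Set (List C)),
      Determined E (v ⁻¹' S ∩ ext γ)) :
    ∃ p, v p ∈ T ∧ ∀ n,
      Wins v Dᶜ (pre p n) {o | ¬ r (v p) o} ∧ Wins v D (pre p n) {o | ¬ s (v p) o} := by
  classical
  obtain ⟨p, hpT⟩ := hT
  have before : ∀ γ o, o ∈ T → ¬ (Wins v D γ T ∨ Wins v Dᶜ γ T) →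
      Wins v Dᶜ γ {w | ¬ r o w} ∧ Wins v D γ {w | ¬ s o w} := by
    intro γ o ho hγ
    rw [not_or] at hγ
    have h1 := (wins_or_wins_compl D (hdet T γ)).resolve_left hγ.1
    have h2 := (wins_or_wins_compl Dᶜ (hdet T γ)).resolve_left hγ.2
    rw [compl_compl] at h2
    exact ⟨h1.mono subset_rfl fun w hw h => hw (hrT o w ho h),
      h2.mono subset_rfl fun w hw h => hw (hsT o w ho h)⟩
  by_cases hex : ∃ n, Wins v D (pre p n) T ∨ Wins v Dᶜ (pre p n) T
  · have hn := Nat.find_spec hex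
    have hmin := fun m => Nat.find_min hex (m := m)
    generalize Nat.find hex = n at hn hmin
    obtain ⟨q, hq, hqT, hafter⟩ : ∃ q ∈ ext (pre p n), v q ∈ T ∧ ∀ m, n ≤ m →
        Wins v Dᶜ (pre q m) {o | ¬ r (v q) o} ∧ Wins v D (pre q m) {o | ¬ s (v q) o} := by
      rcases hn with hn | hn
      · simpa using exists_play_of_wins_slice hr hwr hws ⟨_, hpT⟩ hrT hsT hrs
          (fun S => hdet S _) hn
      · simpa [and_comm] using exists_play_of_wins_slice hs hws hwr ⟨_, hpT⟩ hsT hrT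
          (fun z w hz hw => (hrs w z hw hz).symm) (fun S => hdet S _) hn
    refine ⟨q, hqT, fun m => ?_⟩
    rcases le_or_gt n m with hm | hm
    · exact hafter m hm
    · rw [pre_eq_of_mem_ext hq hm.le]
      exact before _ _ hqT (hmin m hm)
  · exact ⟨p, hpT, fun n => before _ _ hpT (not_exists.1 hex n)⟩

/-- Two preferences with distinct maxima `x` and `y` that avoid the forbidden pattern have
the same outcomes above the other one's maximum, and are opposite on these. -/
theorem opposite_of_distinct_maxima {r s : O → O → Prop} (hr : SLO r) (hs : SLO s)
    (hrs : ¬ ∃ x y z, r z y ∧ r y x ∧ s x z ∧ s z y)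
    (hsr : ¬ ∃ x y z, s z y ∧ s y x ∧ r x z ∧ r z y)
    {x y : O} (hxy : x ≠ y) (hx : ∀ w, ¬ r x w) (hy : ∀ w, ¬ s y w) :
    (∀ z, r z y ↔ s z x) ∧ ∀ z w, ¬ r z y → ¬ r w y → r z w → s w z := by
  obtain ⟨hr1, hr2, hr3⟩ := hr
  obtain ⟨hs1, hs2, hs3⟩ := hs
  have hyx : r y x := by grind
  have hxy' : s x y := by grind
  have key : ∀ z, r z y ↔ s z x := by
    intro z
    constructor
    · intro h
      by_contra h'
      have : s x z := by grind
      have : s z y := by grind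
      exact hrs ⟨x, y, z, h, hyx, by assumption, by assumption⟩
    · intro h
      by_contra h'
      have : r y z := by grind
      have : r z x := by grind
      exact hsr ⟨y, x, z, h, hxy', by assumption, by assumption⟩
  refine ⟨key, fun z w hz hw hzw => ?_⟩
  by_contra h
  have h1 : s z w := by grind
  have h2 : r y z := by grind
  have h3 : s w y := by grind
  exact hsr ⟨y, w, z, h1, h3, h2, hzw⟩

/-- Under the forbidden pattern condition, a third preference agreeing with `r` on the
maxima of `r` and `s` has the same maximum as `r`. -/
theorem maximum_of_distinct_maxima {r s t : O → O → Prop} (hr : SLO r) (hs : SLO s)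
    (ht : SLO t)
    (hrs : ¬ ∃ x y z, r z y ∧ r y x ∧ s x z ∧ s z y)
    (hsr : ¬ ∃ x y z, s z y ∧ s y x ∧ r x z ∧ r z y)
    (hst : ¬ ∃ x y z, s z y ∧ s y x ∧ t x z ∧ t z y)
    (htr : ¬ ∃ x y z, t z y ∧ t y x ∧ r x z ∧ r z y)
    {x y : O} (hx : ∀ w, ¬ r x w) (hy : ∀ w, ¬ s y w) (hxy : t y x) (w : O) :
    ¬ t x w := by
  intro hw
  have hne : x ≠ y := by
    rintro rfl
    exact ht.1 _ hxy
  have key := (opposite_of_distinct_maxima hr hs hrs hsr hne hx hy).1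
  obtain ⟨hr1, hr2, hr3⟩ := hr
  obtain ⟨hs1, hs2, hs3⟩ := hs
  obtain ⟨ht1, ht2, ht3⟩ := ht
  by_cases h : s w x
  · exact htr ⟨w, x, y, hxy, hw, (key w).2 h, by grind⟩
  · exact hst ⟨y, w, x, by grind, by grind, hxy, hw⟩

end SeqGame

open SeqGame in
/-- if the (strict linear) preferences have well-founded inverses and avoid
the forbidden pattern, then every infinite sequential game with these preferences, all
outcomes realizable, and determinacy of the induced win/lose games, has a Pareto-optimal
Nash equilibrium. -/
theorem stmt16 {A O : Type*} [Nonempty A] [Nonempty O]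
    (prec : A → O → O → Prop)
    (hSLO : ∀ a : A, SLO (prec a))
    (hwf : ∀ a : A, ¬ ∃ o : ℕ → O, ∀ k : ℕ, prec a (o k) (o (k + 1)))
    (hpat : ¬ ∃ (a b : A) (x y z : O),
      prec a z y ∧ prec a y x ∧ prec b x z ∧ prec b z y)
    {C : Type*} [Nonempty C] (d : List C → A) (v : (ℕ → C) → O)
    (hv : Function.Surjective v)
    (hdet : ∀ (O' : Set O) (γ : List C) (D : Set (List C)),
      Determined D (v ⁻¹' O' ∩ ext γ)) :
    ∃ σ : List C → C,
      (∀ (a : A) (σ' : List C → C), Dev d a σ σ' →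
        ¬ prec a (v (play σ [])) (v (play σ' []))) ∧
      ParetoOpt v prec (v (play σ [])) := by
  classical
  have hmax : ∀ c, ∃ m, ∀ w, ¬ prec c m w := fun c => by
    obtain ⟨m, -, hm⟩ := exists_maximal_of_no_chain (hwf c) Set.univ_nonempty
    exact ⟨m, fun w => hm w trivial⟩
  have hp : ∀ a b, ¬ ∃ x y z, prec a z y ∧ prec a y x ∧ prec b x z ∧ prec b z y :=
    fun a b h => hpat ⟨a, b, h⟩
  by_cases hcommon : ∃ m, ∀ c w, ¬ prec c m w
  · obtain ⟨m, hm⟩ := hcommon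
    obtain ⟨p, rfl⟩ := hv m
    obtain ⟨σ, hσ, hne⟩ := exists_nash_of_forall_wins (fun c => (hSLO c).1) p
      fun n => wins_of_forall (D := {h | d h ≠ d (pre p n)}) fun o => hm (d (pre p n)) o
    refine ⟨σ, hne, ?_⟩
    rintro ⟨q, -, -, ⟨c, hc⟩, -⟩
    rw [hσ] at hc
    exact hm c q hc
  obtain ⟨a⟩ := ‹Nonempty A›
  obtain ⟨x, hx⟩ := hmax a
  obtain ⟨b, hb⟩ : ∃ b, ∃ w, prec b x w := by
    by_contra! h
    exact hcommon ⟨x, h⟩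
  obtain ⟨y, hy⟩ := hmax b
  have hxy : x ≠ y := by
    rintro rfl
    exact hb.elim hy
  obtain ⟨hT, hab⟩ := opposite_of_distinct_maxima (hSLO a) (hSLO b) (hp a b) (hp b a) hxy hx hy
  have hba := (opposite_of_distinct_maxima (hSLO b) (hSLO a) (hp b a) (hp a b) hxy.symm hy hx).2
  set T : Set O := {z | ¬ prec a z y} with hTdef
  have mem_iff : ∀ z, z ∈ T ↔ ¬ prec b z x := fun z => not_congr (hT z)
  have haT : ∀ z w, z ∈ T → prec a z w → w ∈ T :=
    fun z w hz h hw => hz ((hSLO a).2.1 z w y h hw)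
  have hbT : ∀ z w, z ∈ T → prec b z w → w ∈ T := by
    intro z w hz h
    rw [mem_iff] at hz ⊢
    exact fun hw => hz ((hSLO b).2.1 z w x h hw)
  have hrev : ∀ z w, z ∈ T → w ∈ T → (prec a z w ↔ prec b w z) := fun z w hz hw =>
    ⟨hab z w hz hw, hba w z ((mem_iff w).1 hw) ((mem_iff z).1 hz)⟩
  have hlike_a : ∀ c, prec c y x → ∀ z w, z ∈ T → prec c z w → prec a z w := by
    intro c hc z w hz hzw
    have hcx := maximum_of_distinct_maxima (hSLO a) (hSLO b) (hSLO c) (hp a b) (hp b a)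
      (hp b c) (hp c a) hx hy hc
    obtain ⟨h1, h2⟩ :=
      opposite_of_distinct_maxima (hSLO c) (hSLO b) (hp c b) (hp b c) hxy hcx hy
    have hzc : ¬ prec c z y := fun h => (mem_iff z).1 hz ((h1 z).1 h)
    have hwc : ¬ prec c w y := fun h => hzc ((hSLO c).2.1 z w y hzw h)
    exact (hrev z w hz ((mem_iff w).2 fun h => hwc ((h1 w).2 h))).2 (h2 z w hzc hwc hzw)
  have hlike_b : ∀ c, ¬ prec c y x → ∀ z w, z ∈ T → prec c z w → prec b z w := by
    intro c hc z w hz hzw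
    have hc' : prec c x y := by
      rcases (hSLO c).2.2 x y with h | h | h
      exacts [absurd h hxy, h, absurd h hc]
    have hcy := maximum_of_distinct_maxima (hSLO b) (hSLO a) (hSLO c) (hp b a) (hp a b)
      (hp a c) (hp c b) hy hx hc'
    obtain ⟨h1, h2⟩ :=
      opposite_of_distinct_maxima (hSLO c) (hSLO a) (hp c a) (hp a c) hxy.symm hcy hx
    have hzc : ¬ prec c z x := fun h => hz ((h1 z).1 h)
    have hwc : ¬ prec c w x := fun h => hzc ((hSLO c).2.1 z w x hzw h)
    have hw : w ∈ T := fun h => hwc ((h1 w).2 h)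
    exact (hrev w z hw hz).1 (h2 z w hzc hwc hzw)
  obtain ⟨p, hpT, hpw⟩ := exists_play_in_slice {h | prec (d h) y x} (hSLO a) (hSLO b)
    (hwf a) (hwf b) ((hv y).imp fun p hp => by rw [hp]; exact (hSLO a).1 y) haT hbT hrev hdet
  obtain ⟨σ, hσ, hne⟩ := exists_nash_of_forall_wins (d := d) (fun c => (hSLO c).1) p fun n => by
    by_cases hd : prec (d (pre p n)) y x
    · refine (hpw n).1.mono (fun h hh heq => hh ?_) fun w hw h => hw (hlike_a _ hd _ _ hpT h)
      simpa only [Set.mem_ofPred_eq, heq] using hd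
    · refine (hpw n).2.mono (fun h hh heq => hd ?_) fun w hw h => hw (hlike_b _ hd _ _ hpT h)
      simpa only [Set.mem_ofPred_eq, heq] using hh
  refine ⟨σ, hne, ?_⟩
  rw [hσ]
  rintro ⟨q, -, -, ⟨c, hc⟩, hall⟩
  by_cases hd : prec c y x
  · have h := hlike_a c hd _ _ hpT hc
    exact hall b ((hrev _ _ hpT (haT _ _ hpT h)).1 h)
  · have h := hlike_b c hd _ _ hpT hc
    exact hall a ((hrev _ _ (hbT _ _ hpT h) hpT).2 h)
end

section
/- Let ≺_a and ≺_b be strict linear orders on a set O and let x, y, z ∈ O satisfy z ≺_a y ≺_a x and x ≺_b z ≺_b y. Consider the two-player infinite sequential game with players {a,b}, choices C = {0,1}, d(ε) = b and d(h) = a for every nonempty h ∈ C*, and outcome function v(p) = z if p_0 = 1, v(p) = x if p_0 = 0 and p_1 = 0, and v(p) = y if p_0 = 0 and p_1 = 1. Then: this game has a Nash equilibrium; every Nash equilibrium σ satisfies v(p(σ)) = z; and no Nash equilibrium of this game is Pareto-optimal. -/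
namespace SeqGame

variable {A C O : Type*}

@[simp] lemma play_nil_zero (σ : List C → C) : play σ [] 0 = σ [] := rfl

@[simp] lemma play_nil_one (σ : List C → C) : play σ [] 1 = σ [σ []] := rfl

lemma SLO.asymm {r : O → O → Prop} (hr : SLO r) {x y : O} (hxy : r x y) : ¬ r y x :=
  fun hyx => hr.1 x (hr.2.1 x y x hxy hyx)

lemma dev_update [DecidableEq C] (d : List C → A) (σ : List C → C) (h : List C) (c : C) :
    Dev d (d h) σ (Function.update σ h c) := by
  intro k hk
  exact Function.update_of_ne (fun hkh => hk (congrArg d hkh)) c σ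

end SeqGame

open SeqGame in
/-- the concrete two-player game on `C = Bool` (`false` is the choice `0`,
`true` is the choice `1`; player `a` is `true`, player `b` is `false`; `b` moves first,
`a` moves everywhere else) with outcomes `v(1…) = z`, `v(00…) = x`, `v(01…) = y`, where
`z ≺_a y ≺_a x` and `x ≺_b z ≺_b y`, has a Nash equilibrium, every Nash equilibrium
induces the outcome `z`, and no Nash equilibrium is Pareto-optimal. -/
theorem stmt17 {O : Type*} (precA precB : O → O → Prop)
    (hA : SLO precA) (hB : SLO precB)
    (x y z : O)
    (hzy : precA z y) (hyx : precA y x) (hxz : precB x z) (hzy' : precB z y)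
    (d : List Bool → Bool) (hd0 : d [] = false)
    (hd1 : ∀ h : List Bool, h ≠ [] → d h = true)
    (v : (ℕ → Bool) → O)
    (hv : ∀ p : ℕ → Bool, v p = if p 0 then z else (if p 1 then y else x)) :
    (∃ σ : List Bool → Bool, ∀ (X : Bool) (σ' : List Bool → Bool), Dev d X σ σ' →
      ¬ rel2 precA precB X (v (play σ [])) (v (play σ' []))) ∧
    (∀ σ : List Bool → Bool,
      (∀ (X : Bool) (σ' : List Bool → Bool), Dev d X σ σ' →
        ¬ rel2 precA precB X (v (play σ [])) (v (play σ' []))) →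
      v (play σ []) = z) ∧
    (∀ σ : List Bool → Bool,
      (∀ (X : Bool) (σ' : List Bool → Bool), Dev d X σ σ' →
        ¬ rel2 precA precB X (v (play σ [])) (v (play σ' []))) →
      ¬ ParetoOpt v (rel2 precA precB) (v (play σ []))) := by
  have hplay (σ : List Bool → Bool) :
      v (play σ []) = if σ [] then z else if σ [σ []] then y else x := by
    rw [hv, play_nil_zero, play_nil_one]
  have hz : ∀ σ : List Bool → Bool,
      (∀ (X : Bool) (σ' : List Bool → Bool), Dev d X σ σ' →
        ¬ rel2 precA precB X (v (play σ [])) (v (play σ' []))) →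
      v (play σ []) = z := by
    intro σ hσ
    cases h0 : σ [] with
    | true => simp [hplay, h0]
    | false =>
      exfalso
      cases h1 : σ [false] with
      | true =>
        have hdev := dev_update d σ [false] false
        rw [hd1 [false] (by simp)] at hdev
        apply hσ true _ hdev
        simpa [hplay, h0, h1, rel2] using hyx
      | false =>
        have hdev := dev_update d σ [] true
        rw [hd0] at hdev
        apply hσ false _ hdev
        simpa [hplay, h0, h1, rel2] using hxz
  refine ⟨⟨fun h => decide (h = []), ?_⟩, hz, ?_⟩
  · intro X σ' hdev
    cases X with
    | true =>
      have h0 : σ' [] = true := by simpa using hdev [] (by simp [hd0])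
      simpa [hplay, h0, rel2] using hA.1 z
    | false =>
      have h1 : σ' [false] = false := by simpa using hdev [false] (by simp [hd1])
      cases h0 : σ' [] with
      | true => simpa [hplay, h0, rel2] using hB.1 z
      | false => simpa [hplay, h0, h1, rel2] using hB.asymm hxz
  · intro σ hσ hopt
    rw [hz σ hσ] at hopt
    refine hopt ⟨y, fun h => hA.1 z (h ▸ hzy), ⟨fun n => decide (n = 1), by simp [hv]⟩,
      ⟨true, hzy⟩, ?_⟩
    rintro (_ | _)
    · exact hB.asymm hzy'
    · exact hA.asymm hzy
end
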